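/- arXiv:1809.05312 — 2 statements merged into one kernel-verified Lean document; each statement's English description precedes it below -/
import Mathlib

section
/- Let X and Y be real Banach spaces, let φ : [0, ∞) → [0, ∞) be a normalization function, and let ψ : Y → ℝ, ψ(u) = ∫₀^{‖u‖} φ(t) dt, be continuously Fréchet differentiable with derivative A : Y → Y* satisfying ‖A(u)‖_{Y*} = φ(‖u‖) and ⟨A(u), u⟩ = ‖A(u)‖_{Y*}‖u‖ for all u ∈ Y (i.e. A is the single-valued duality mapping corresponding to φ and ψ is its potential). Let f : X → Y be a C¹-mapping such that: (A5) for every y ∈ Y the functional h : X → ℝ given by h(x) = ψ(f(x) − y) satisfies the Palais–Smale condition; (A6) for every x ∈ X the Fréchet derivative f'(x) is a continuous linear bijection from X onto Y. Then f is a diffeomorphism. -/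
open Filter Topology

/-- A form of **Ekeland's variational principle**: a nonnegative continuous function on a complete
metric space has, for every slope `c > 0` and starting point `u`, an almost minimizer `v` close
to `u`. -/
theorem exists_forall_le_add_mul_dist {α : Type*} [MetricSpace α] [CompleteSpace α] {h : α → ℝ}
    (hcont : Continuous h) (hnonneg : ∀ x, 0 ≤ h x) {c : ℝ} (hc : 0 < c) (u : α) :
    ∃ v, h v + c * dist v u ≤ h u ∧ ∀ w, h v ≤ h w + c * dist w v := by
  have step : ∀ (n : ℕ) (x : α), ∃ x', h x' + c * dist x' x ≤ h x ∧
      ∀ w, h w + c * dist w x ≤ h x → h x' ≤ h w + (1 / 2 : ℝ) ^ n := by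
    intro n x
    let S : Set ℝ := h '' {w | h w + c * dist w x ≤ h x}
    have hne : S.Nonempty := ⟨h x, x, by simp, rfl⟩
    have hbdd : BddBelow S := ⟨0, by rintro _ ⟨w, -, rfl⟩; exact hnonneg w⟩
    obtain ⟨_, ⟨x', hx', rfl⟩, hlt⟩ :=
      exists_lt_of_csInf_lt hne (lt_add_of_pos_right _ (by positivity : (0 : ℝ) < (1 / 2) ^ n))
    refine ⟨x', hx', fun w hw => ?_⟩
    have := csInf_le hbdd ⟨w, hw, rfl⟩
    linarith
  choose next hnext hnext' using step
  let x : ℕ → α := fun n => Nat.rec u (fun n y => next n y) n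
  have htrans : ∀ a b d : α, h a + c * dist a b ≤ h b → h b + c * dist b d ≤ h d →
      h a + c * dist a d ≤ h d := by
    intro a b d hab hbd
    nlinarith [dist_triangle a b d]
  have hmono : ∀ n m, n ≤ m → h (x m) + c * dist (x m) (x n) ≤ h (x n) := by
    intro n m hnm
    induction m, hnm using Nat.le_induction with
    | base => simp
    | succ m _ ih => exact htrans _ _ _ (hnext m (x m)) ih
  have hclose : ∀ n w, h w + c * dist w (x (n + 1)) ≤ h (x (n + 1)) →
      dist w (x (n + 1)) ≤ (1 / 2 : ℝ) ^ n / c := by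
    intro n w hw
    have : h (x (n + 1)) ≤ h w + (1 / 2 : ℝ) ^ n :=
      hnext' n (x n) w (htrans _ _ _ hw (hnext n (x n)))
    rw [le_div_iff₀' hc]
    linarith
  have hlim : Tendsto (fun n : ℕ => (1 / 2 : ℝ) ^ n / c) atTop (𝓝 0) := by
    simpa using (tendsto_pow_atTop_nhds_zero_of_lt_one (by norm_num : (0 : ℝ) ≤ 1 / 2)
      (by norm_num)).div_const c
  obtain ⟨v, hv⟩ := cauchySeq_tendsto_of_complete
    (cauchySeq_of_le_tendsto_0' (s := fun n => x (n + 1)) _ (fun n m hnm => by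
      rw [dist_comm]
      exact hclose n _ (hmono (n + 1) (m + 1) (Nat.succ_le_succ hnm))) hlim)
  have hxv : Tendsto x atTop (𝓝 v) := (tendsto_add_atTop_iff_nat 1).1 hv
  have hmem : ∀ n, h v + c * dist v (x n) ≤ h (x n) := fun n =>
    le_of_tendsto (((hcont.tendsto v).comp hxv).add ((hxv.dist tendsto_const_nhds).const_mul c))
      (eventually_atTop.2 ⟨n, fun m hm => hmono n m hm⟩)
  refine ⟨v, hmem 0, fun w => ?_⟩
  by_cases hw : h w + c * dist w v ≤ h v
  · have hwx : Tendsto (fun n => x (n + 1)) atTop (𝓝 w) := by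
      rw [tendsto_iff_dist_tendsto_zero]
      refine squeeze_zero (fun _ => dist_nonneg) (fun n => ?_) hlim
      rw [dist_comm]
      exact hclose n w (htrans _ _ _ hw (hmem (n + 1)))
    simp [tendsto_nhds_unique hwx hv]
  · exact (not_le.1 hw).le

theorem norm_fderiv_le_of_forall_le_add_mul_dist {E : Type*} [NormedAddCommGroup E]
    [NormedSpace ℝ E] {h : E → ℝ} {v : E} {c : ℝ} (hc : 0 ≤ c) (hd : DifferentiableAt ℝ h v)
    (hv : ∀ w, h v ≤ h w + c * dist w v) : ‖fderiv ℝ h v‖ ≤ c := by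
  have key : ∀ d, -(c * ‖d‖) ≤ fderiv ℝ h v d := by
    intro d
    have hline : HasDerivAt (fun t : ℝ => h (v + t • d)) (fderiv ℝ h v d) 0 :=
      hd.hasFDerivAt.hasLineDerivAt d
    have hslope := hline.tendsto_slope_zero_right
    refine ge_of_tendsto hslope ?_
    filter_upwards [self_mem_nhdsWithin] with t ht
    have ht : 0 < t := ht
    have := hv (v + t • d)
    rw [dist_eq_norm, add_sub_cancel_left, norm_smul, Real.norm_of_nonneg ht.le] at this
    simp only [zero_add, zero_smul, add_zero, smul_eq_mul]
    rw [inv_mul_eq_div, le_div_iff₀ ht]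
    linarith
  refine ContinuousLinearMap.opNorm_le_bound _ hc fun d => abs_le.2 ⟨key d, ?_⟩
  have := key (-d)
  rw [map_neg, norm_neg] at this
  linarith

/-- A minimizing sequence of a nonnegative `C¹` function with infimum `0` that satisfies the
Palais–Smale condition has a convergent subsequence. -/
theorem exists_tendsto_subseq_of_palaisSmale {E : Type*} [NormedAddCommGroup E]
    [NormedSpace ℝ E] [CompleteSpace E] {h : E → ℝ} (hdiff : Differentiable ℝ h)
    (hnonneg : ∀ x, 0 ≤ h x)
    (hPS : ∀ u : ℕ → E, (∃ M : ℝ, ∀ n, |h (u n)| ≤ M) →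
      Tendsto (fun n => ‖fderiv ℝ h (u n)‖) atTop (𝓝 0) →
      ∃ v : E, ∃ σ : ℕ → ℕ, StrictMono σ ∧ Tendsto (u ∘ σ) atTop (𝓝 v))
    {u : ℕ → E} (hu : Tendsto (fun n => h (u n)) atTop (𝓝 0)) :
    ∃ v : E, ∃ σ : ℕ → ℕ, StrictMono σ ∧ Tendsto (u ∘ σ) atTop (𝓝 v) := by
  let ε : ℕ → ℝ := fun n => h (u n) + 1 / ((n : ℝ) + 1)
  have hεpos : ∀ n, 0 < ε n := fun n => add_pos_of_nonneg_of_pos (hnonneg _) (by positivity)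
  have hε : Tendsto (fun n => √(ε n)) atTop (𝓝 0) := by
    simpa [ε] using (hu.add tendsto_one_div_add_atTop_nhds_zero_nat).sqrt
  choose v hvu hv using fun n => exists_forall_le_add_mul_dist hdiff.continuous hnonneg
    (Real.sqrt_pos.2 (hεpos n)) (u n)
  have hdist : ∀ n, dist (u n) (v n) ≤ √(ε n) := by
    intro n
    have hpos := Real.sqrt_pos.2 (hεpos n)
    have hsq := Real.mul_self_sqrt (hεpos n).le
    have hle : h (u n) ≤ ε n := le_add_of_nonneg_right (by positivity)
    rw [dist_comm]
    refine le_of_mul_le_mul_left ?_ hpos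
    linarith [hvu n, hnonneg (v n)]
  obtain ⟨M, hM⟩ := hu.bddAbove_range
  obtain ⟨a, σ, hσ, ha⟩ := hPS v
    ⟨M, fun n => by
      have h1 : h (u n) ≤ M := hM ⟨n, rfl⟩
      have h2 : 0 ≤ √(ε n) * dist (v n) (u n) := by positivity
      rw [abs_of_nonneg (hnonneg _)]
      linarith [hvu n]⟩
    (squeeze_zero (fun _ => norm_nonneg _) (fun n =>
      norm_fderiv_le_of_forall_le_add_mul_dist (Real.sqrt_nonneg _) (hdiff _) (hv n)) hε)
  refine ⟨a, σ, hσ, (tendsto_iff_of_dist ?_).2 ha⟩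
  exact squeeze_zero (fun _ => dist_nonneg) (fun n => hdist (σ n)) (hε.comp hσ.tendsto_atTop)

/-- A continuous map between metric spaces is proper if every sequence whose image converges has a
convergent subsequence. -/
theorem isProperMap_of_exists_tendsto_subseq {α β : Type*} [MetricSpace α] [MetricSpace β]
    {f : α → β} (hf : Continuous f)
    (h : ∀ (u : ℕ → α) (y : β), Tendsto (f ∘ u) atTop (𝓝 y) →
      ∃ v : α, ∃ σ : ℕ → ℕ, StrictMono σ ∧ Tendsto (u ∘ σ) atTop (𝓝 v)) :
    IsProperMap f := by
  refine isProperMap_iff_isCompact_preimage.2 ⟨hf, fun K hK => IsSeqCompact.isCompact ?_⟩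
  intro u hu
  obtain ⟨y, -, τ, hτ, hy⟩ := hK.isSeqCompact hu
  obtain ⟨v, σ, hσ, hv⟩ := h (u ∘ τ) y hy
  exact ⟨v, (hK.isClosed.preimage hf).mem_of_tendsto hv (Eventually.of_forall fun n => hu _),
    τ ∘ σ, hτ.comp hσ, hv⟩

/-- A proper local homeomorphism from a nonempty connected Hausdorff space to a simply connected,
locally path connected Hausdorff space has a continuous inverse. -/
theorem IsProperMap.exists_continuous_inverse {α β : Type*} [TopologicalSpace α]
    [TopologicalSpace β] [T2Space α] [T2Space β] [ConnectedSpace α] [SimplyConnectedSpace β]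
    [LocallyPathConnectedSpace β] {f : α → β} (hf : IsProperMap f) (hloc : IsLocalHomeomorph f) :
    ∃ g : β → α, Continuous g ∧ Function.LeftInverse g f ∧ Function.RightInverse g f := by
  have hcov : IsCoveringMap f := by
    rw [isCoveringMap_iff_isCoveringMapOn_univ]
    refine hf.isClosedMap.isCoveringMapOn_of_isLocalHomeomorphOn (fun y _ => ?_)
      fun e _ => hloc e
    exact (hf.isCompact_preimage isCompact_singleton).finite
      (.of_openPartialHomeomorph f subset_rfl fun e _ => by
        obtain ⟨φ, he, rfl⟩ := hloc e
        exact ⟨φ, he, rfl⟩)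
  obtain ⟨a⟩ : Nonempty α := inferInstance
  obtain ⟨g, ⟨hga, hfg⟩, -⟩ := hcov.existsUnique_continuousMap_lifts (.id β) (f a) a rfl
  refine ⟨g, g.continuous, fun x => ?_, fun y => congrFun hfg y⟩
  have : g ∘ f = id := hcov.eq_of_comp_eq (g.continuous.comp hf.continuous) continuous_id
    (by rw [← Function.comp_assoc, hfg]; rfl) a hga
  exact congrFun this x

/-- (Theorem 3.11 of the paper.) Let `X`, `Y` be real Banach spaces, `φ` a normalization
function and `ψ(u) = ∫₀^{‖u‖} φ(t) dt` continuously Fréchet differentiable with derivative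
`A : Y → Y*` the duality mapping corresponding to `φ`, i.e. `‖A(u)‖ = φ(‖u‖)` and
`⟨A(u), u⟩ = ‖A(u)‖‖u‖` for all `u`. Let `f : X → Y` be a `C¹`-mapping such that:
(A5) for every `y ∈ Y` the functional `h(x) = ψ(f(x) − y)` satisfies the Palais–Smale
condition; (A6) `f'(x)` is a continuous linear bijection from `X` onto `Y` for every `x`.
Then `f` is a diffeomorphism. -/
theorem global_diffeomorphism_duality_mapping
    {X Y : Type*} [NormedAddCommGroup X] [NormedSpace ℝ X] [CompleteSpace X]
    [NormedAddCommGroup Y] [NormedSpace ℝ Y] [CompleteSpace Y]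
    (φ : ℝ → ℝ)
    (hφcont : Continuous φ)
    (hφmono : StrictMonoOn φ (Set.Ici 0))
    (hφ0 : φ 0 = 0)
    (hφtop : Filter.Tendsto φ Filter.atTop Filter.atTop)
    (ψ : Y → ℝ)
    (hψdef : ∀ u : Y, ψ u = ∫ t in (0 : ℝ)..‖u‖, φ t)
    (hψ : ContDiff ℝ 1 ψ)
    (hA_norm : ∀ u : Y, ‖fderiv ℝ ψ u‖ = φ ‖u‖)
    (hA_pair : ∀ u : Y, fderiv ℝ ψ u u = ‖fderiv ℝ ψ u‖ * ‖u‖)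
    (f : X → Y)
    (hf : ContDiff ℝ 1 f)
    (hA5 : ∀ y : Y,
      ∀ u : ℕ → X,
        (∃ M : ℝ, ∀ n : ℕ, |ψ (f (u n) - y)| ≤ M) →
        Filter.Tendsto (fun n => ‖fderiv ℝ (fun x => ψ (f x - y)) (u n)‖)
          Filter.atTop (nhds 0) →
        ∃ v : X, ∃ σ : ℕ → ℕ, StrictMono σ ∧
          Filter.Tendsto (u ∘ σ) Filter.atTop (nhds v))
    (hA6 : ∀ x : X, Function.Bijective (fderiv ℝ f x)) :
    Function.Bijective f ∧
      ∃ g : Y → X, Function.LeftInverse g f ∧ Function.RightInverse g f ∧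
        ContDiff ℝ 1 g := by
  have hψnonneg : ∀ u, 0 ≤ ψ u := fun u => by
    rw [hψdef]
    refine intervalIntegral.integral_nonneg (norm_nonneg u) fun t ht => ?_
    rw [← hφ0]
    exact hφmono.monotoneOn Set.self_mem_Ici ht.1 ht.1
  have hψ0 : ψ 0 = 0 := by simp [hψdef]
  have hproper : IsProperMap f := by
    refine isProperMap_of_exists_tendsto_subseq hf.continuous fun u y huy => ?_
    refine exists_tendsto_subseq_of_palaisSmale (h := fun x => ψ (f x - y))
      ((hψ.differentiable one_ne_zero).comp ((hf.differentiable one_ne_zero).sub_const y))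
      (fun x => hψnonneg _) (hA5 y) ?_
    have hsub : Tendsto (fun n => f (u n) - y) atTop (𝓝 0) := by
      simpa using huy.sub_const y
    simpa only [hψ0, Function.comp_def] using (hψ.continuous.tendsto 0).comp hsub
  let f' : X → X ≃L[ℝ] Y := fun x => ContinuousLinearEquiv.ofBijective (fderiv ℝ f x)
    (LinearMap.ker_eq_bot.2 (hA6 x).1) (LinearMap.range_eq_top.2 (hA6 x).2)
  have hf' : ∀ x, HasFDerivAt f (f' x : X →L[ℝ] Y) x := fun x =>
    (hf.differentiable one_ne_zero x).hasFDerivAt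
  have hloc : IsLocalHomeomorph f := fun x =>
    ⟨hf.contDiffAt.toOpenPartialHomeomorph f (hf' x) one_ne_zero,
      hf.contDiffAt.mem_toOpenPartialHomeomorph_source (hf' x) one_ne_zero, rfl⟩
  obtain ⟨g, hg, hleft, hright⟩ := hproper.exists_continuous_inverse hloc
  let e : X ≃ₜ Y := ⟨⟨f, g, hleft, hright⟩, hf.continuous, hg⟩
  exact ⟨e.bijective, g, hleft, hright, e.contDiff_symm hf' hf⟩
end

section
/- Let A be an n × n real matrix and let F : ℝⁿ → ℝⁿ be a C¹-mapping with det(A − F'(x)) ≠ 0 for every x ∈ ℝⁿ. Assume that either (iia) A is invertible and there exist constants α > 0 and 0 < γ < 1 such that ‖F(x)‖ ≤ α‖x‖^γ for all x ∈ ℝⁿ of sufficiently large norm, or (iib) there exist constants β > 0 and θ > 1 such that ‖F(x)‖ ≥ β‖x‖^θ for all x ∈ ℝⁿ of sufficiently large norm. Then the map φ : ℝⁿ → ℝⁿ, φ(x) = Ax − F(x), satisfies ‖φ(x)‖ → ∞ as ‖x‖ → ∞, and consequently for every ξ ∈ ℝⁿ the equation Ax − F(x) = ξ has exactly one solution x ∈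 ℝⁿ. -/
/-- A proper local homeomorphism onto a simply connected, locally path connected space
from a nonempty path connected space is a bijection. -/
theorem IsLocalHomeomorph.bijective_of_isProperMap {E X : Type*} [TopologicalSpace E]
    [TopologicalSpace X] [T2Space E] [T1Space X] [PathConnectedSpace E] [SimplyConnectedSpace X]
    [LocallyPathConnectedSpace X] {f : E → X} (hf : IsLocalHomeomorph f) (hp : IsProperMap f) :
    Function.Bijective f := by
  have hfin (x : X) : (f ⁻¹' {x}).Finite :=
    (hp.isCompact_preimage isCompact_singleton).finite
      (.of_openPartialHomeomorph f subset_rfl fun e _ => by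
        obtain ⟨φ, hφ, rfl⟩ := hf e
        exact ⟨φ, hφ, rfl⟩)
  have hcov : IsCoveringMap f := by
    rw [isCoveringMap_iff_isCoveringMapOn_univ]
    exact hp.isClosedMap.isCoveringMapOn_of_isLocalHomeomorphOn (fun x _ => hfin x)
      fun e _ => hf e
  let e₀ : E := Classical.arbitrary E
  obtain ⟨s, ⟨hs₀, hs⟩, -⟩ :=
    hcov.existsUnique_continuousMap_lifts (ContinuousMap.id X) (f e₀) e₀ rfl
  have hfs (x : X) : f (s x) = x := congr_fun hs x
  have hsf : s ∘ f = id :=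
    hcov.eq_of_comp_eq (s.continuous.comp hp.continuous) continuous_id
      (by ext e; simp [hfs]) e₀ hs₀
  exact ⟨Function.LeftInverse.injective (g := s) fun e => congr_fun hsf e,
    Function.RightInverse.surjective hfs⟩

/-- **Hadamard's global inversion theorem**: a coercive `C¹` self-map of a finite-dimensional
real normed space with everywhere nonsingular derivative is a bijection. -/
theorem ContDiff.bijective_of_tendsto_cocompact {E : Type*} [NormedAddCommGroup E]
    [NormedSpace ℝ E] [FiniteDimensional ℝ E] {f : E → E} (hf : ContDiff ℝ 1 f)
    (hdet : ∀ x, LinearMap.det (fderiv ℝ f x).toLinearMap ≠ 0)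
    (hco : Filter.Tendsto f (Filter.cocompact E) (Filter.cocompact E)) :
    Function.Bijective f := by
  have : ProperSpace E := FiniteDimensional.proper_real E
  have : CompleteSpace E := FiniteDimensional.complete ℝ E
  have hloc : IsLocalHomeomorph f := fun x => by
    have hder : HasStrictFDerivAt f
        (((fderiv ℝ f x).toContinuousLinearEquivOfDetNeZero (hdet x) : E ≃L[ℝ] E) : E →L[ℝ] E)
        x := by
      rw [ContinuousLinearMap.coe_toContinuousLinearEquivOfDetNeZero]
      exact hf.contDiffAt.hasStrictFDerivAt one_ne_zero
    exact ⟨hder.toOpenPartialHomeomorph f, hder.mem_toOpenPartialHomeomorph_source, rfl⟩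
  exact hloc.bijective_of_isProperMap
    (isProperMap_iff_tendsto_cocompact.2 ⟨hf.continuous, hco⟩)

/-- A sublinear power is eventually dominated by any positive multiple of the identity. -/
theorem tendsto_mul_sub_mul_rpow_atTop {c α γ : ℝ} (hc : 0 < c) (hγ : γ < 1) :
    Filter.Tendsto (fun r : ℝ => c * r - α * r ^ γ) Filter.atTop Filter.atTop := by
  have h : Filter.Tendsto (fun r : ℝ => c - α * r ^ (-(1 - γ))) Filter.atTop (nhds c) := by
    simpa using ((tendsto_rpow_neg_atTop (sub_pos.2 hγ)).const_mul α).const_sub c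
  refine (Filter.tendsto_id.atTop_mul_pos hc h).congr' ?_
  filter_upwards [Filter.eventually_gt_atTop 0] with r hr
  have hpow : r ^ γ = r * r ^ (-(1 - γ)) := by
    rw [show γ = 1 + -(1 - γ) by ring, Real.rpow_add hr, Real.rpow_one]
    ring_nf
  rw [hpow, id]
  ring

/-- A superlinear power eventually dominates any multiple of the identity. -/
theorem tendsto_mul_rpow_sub_mul_atTop {β θ C : ℝ} (hβ : 0 < β) (hθ : 1 < θ) :
    Filter.Tendsto (fun r : ℝ => β * r ^ θ - C * r) Filter.atTop Filter.atTop := by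
  have h : Filter.Tendsto (fun r : ℝ => β * r ^ (θ - 1) - C) Filter.atTop Filter.atTop :=
    Filter.tendsto_atTop_add_const_right _ (-C)
      ((tendsto_rpow_atTop (sub_pos.2 hθ)).const_mul_atTop hβ)
  refine (Filter.tendsto_id.atTop_mul_atTop₀ h).congr' ?_
  filter_upwards [Filter.eventually_gt_atTop 0] with r hr
  have hpow : r ^ θ = r * r ^ (θ - 1) := by
    rw [← Real.rpow_one_add' hr.le] <;> grind
  rw [hpow, id]
  ring

/-- (Remark 4.2 of the paper, combined with Theorem 2.1.) Let `A` be an `n × n` real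
matrix and `F : ℝⁿ → ℝⁿ` a `C¹`-mapping with `det(A − F'(x)) ≠ 0` for all `x`. If either
(iia) `A` is invertible and there are `α > 0`, `0 < γ < 1` with `‖F(x)‖ ≤ α‖x‖^γ` for all
`x` of sufficiently large norm, or (iib) there are `β > 0`, `θ > 1` with
`‖F(x)‖ ≥ β‖x‖^θ` for all `x` of sufficiently large norm, then `φ(x) = Ax − F(x)`
satisfies `‖φ(x)‖ → ∞` as `‖x‖ → ∞` and for every `ξ ∈ ℝⁿ` the equation
`Ax − F(x) = ξ` has exactly one solution. -/
theorem algebraic_equation_unique_solution_power_growth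
    {n : ℕ} (A : Matrix (Fin n) (Fin n) ℝ)
    (F : EuclideanSpace ℝ (Fin n) → EuclideanSpace ℝ (Fin n))
    (hF : ContDiff ℝ 1 F)
    (hdet : ∀ x : EuclideanSpace ℝ (Fin n),
      LinearMap.det (Matrix.toEuclideanLin A - (fderiv ℝ F x : _ →L[ℝ] _).toLinearMap) ≠ 0)
    (hgrowth :
      (IsUnit A.det ∧
        ∃ α γ : ℝ, 0 < α ∧ 0 < γ ∧ γ < 1 ∧
          ∃ R : ℝ, ∀ x : EuclideanSpace ℝ (Fin n), R ≤ ‖x‖ → ‖F x‖ ≤ α * ‖x‖ ^ γ) ∨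
      (∃ β θ : ℝ, 0 < β ∧ 1 < θ ∧
          ∃ R : ℝ, ∀ x : EuclideanSpace ℝ (Fin n), R ≤ ‖x‖ → β * ‖x‖ ^ θ ≤ ‖F x‖)) :
    Filter.Tendsto (fun x : EuclideanSpace ℝ (Fin n) => ‖Matrix.toEuclideanLin A x - F x‖)
        (Filter.comap (fun x : EuclideanSpace ℝ (Fin n) => ‖x‖) Filter.atTop)
        Filter.atTop ∧
      ∀ ξ : EuclideanSpace ℝ (Fin n),
        ∃! x : EuclideanSpace ℝ (Fin n), Matrix.toEuclideanLin A x - F x = ξ := by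
  set L := LinearMap.toContinuousLinearMap (Matrix.toEuclideanLin A) with hL
  have hLx (x) : Matrix.toEuclideanLin A x = L x := rfl
  have hco : Filter.Tendsto (fun x : EuclideanSpace ℝ (Fin n) => ‖L x - F x‖)
      (Filter.comap (fun x : EuclideanSpace ℝ (Fin n) => ‖x‖) Filter.atTop) Filter.atTop := by
    have hnorm : Filter.Tendsto (fun x : EuclideanSpace ℝ (Fin n) => ‖x‖)
        (Filter.comap (fun x : EuclideanSpace ℝ (Fin n) => ‖x‖) Filter.atTop) Filter.atTop :=
      Filter.tendsto_comap
    rcases hgrowth with ⟨hA, α, γ, -, -, hγ, R, hR⟩ | ⟨β, θ, hβ, hθ, R, hR⟩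
    · have hinj : Function.Injective L := fun x y hxy => by
        have hmul : A.mulVec x.ofLp = A.mulVec y.ofLp := congrArg WithLp.ofLp hxy
        exact WithLp.ofLp_injective 2
          (Matrix.mulVec_injective_of_isUnit ((Matrix.isUnit_iff_isUnit_det A).2 hA) hmul)
      obtain ⟨K, hK, hanti⟩ := L.toLinearMap.exists_antilipschitzWith (LinearMap.ker_eq_bot.2 hinj)
      have hK' : (0 : ℝ) < K := hK
      refine Filter.tendsto_atTop_mono' _ ?_
        ((tendsto_mul_sub_mul_rpow_atTop (α := α) (inv_pos.2 hK') hγ).comp hnorm)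
      filter_upwards [hnorm.eventually_ge_atTop R] with x hx
      have hbound : ‖x‖ ≤ K * ‖L x‖ := by simpa using hanti.le_mul_dist x 0
      have hlower : (K : ℝ)⁻¹ * ‖x‖ ≤ ‖L x‖ := by rwa [inv_mul_le_iff₀ hK']
      have htri := norm_sub_norm_le (L x) (F x)
      have hFx := hR x hx
      simp only [Function.comp_apply]
      linarith
    · refine Filter.tendsto_atTop_mono' _ ?_
        ((tendsto_mul_rpow_sub_mul_atTop (C := ‖L‖) hβ hθ).comp hnorm)
      filter_upwards [hnorm.eventually_ge_atTop R] with x hx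
      have hupper := L.le_opNorm x
      have htri := norm_sub_norm_le (F x) (L x)
      rw [norm_sub_rev] at htri
      have hFx := hR x hx
      simp only [Function.comp_apply]
      linarith
  refine ⟨hco, Function.bijective_iff_existsUnique _ |>.1 ?_⟩
  refine ContDiff.bijective_of_tendsto_cocompact (f := fun x => L x - F x)
    (L.contDiff.sub hF) (fun x => ?_) ?_
  · have hder : fderiv ℝ (fun x => L x - F x) x = L - fderiv ℝ F x :=
      (L.hasFDerivAt.sub (hF.differentiable one_ne_zero x).hasFDerivAt).fderiv
    rw [hder]
    exact hdet x
  · rw [← Metric.cobounded_eq_cocompact, ← tendsto_norm_atTop_iff_cobounded,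
      ← comap_norm_atTop]
    exact hco
end
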